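/- arXiv:1701.02024 — 3 statements merged into one kernel-verified Lean document; each statement's English description precedes it below -/
import Mathlib

section
/- The fundamental group of the circle is isomorphic to the integers: for the unit circle S¹ = {z ∈ ℂ : |z| = 1} with basepoint 1, the fundamental group π₁(S¹, 1) is isomorphic as a group to ℤ. -/
open Real

attribute [local instance] Path.Homotopic.setoid

/-- The loop `eₙ : [0,1] → S¹`, `eₙ(t) = exp (2 π i n t)`, based at `1`. -/
noncomputable def circleLoop (n : ℤ) : Path (1 : Circle) 1 where
  toFun t := Circle.exp (2 * π * n * t)
  continuous_toFun := Circle.exp.continuous.comp (by fun_prop)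
  source' := by simp
  target' := by simp [Circle.exp_two_pi_mul_int]

/-- The fundamental group of the circle is isomorphic to the integers. -/
theorem pi1_circle_iso_int :
    Nonempty (FundamentalGroup Circle (1 : Circle) ≃* Multiplicative ℤ) := by
  have : Infinite (AddSubgroup.zmultiples (2 * π)) :=
    Set.infinite_coe_iff.mpr <| infinite_zmultiples.mpr <|
      not_isOfFinAddOrder_of_isAddTorsionFree two_pi_pos.ne'
  exact ⟨(Circle.isAddQuotientCoveringMap_exp.fundamentalGroupEquiv ⟨0, Circle.exp_zero⟩).trans <|
    (MulOpposite.opMulEquiv (M := Multiplicative (AddSubgroup.zmultiples (2 * π)))).symm.trans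
      (intCyclicAddEquiv (G := AddSubgroup.zmultiples (2 * π))).symm.toMultiplicative⟩
end

section
/- Every loop in the circle based at 1 is path-homotopic (rel endpoints) to the standard loop eₙ(t) = exp(2πint) for exactly one integer n; that is, the loops eₙ for n ∈ ℤ form a complete and irredundant set of representatives for homotopy classes of loops at 1. -/
open Real

/-- The linear path in `ℝ` from `0` to `2πn`, which lifts `circleLoop n`. -/
noncomputable def circleLoopLift (n : ℤ) : Path (0 : ℝ) (2 * π * n) where
  toFun t := 2 * π * n * t
  continuous_toFun := by fun_prop
  source' := by simp
  target' := by simp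

/-- A loop with a lift through `Circle.exp` from `0` to `2πn` is homotopic to `circleLoop n`. -/
theorem homotopic_circleLoop_of_lift {γ : Path (1 : Circle) 1} {n : ℤ}
    (Γ : Path (0 : ℝ) (2 * π * n))
    (h : ∀ t, Circle.exp (Γ t) = γ t) : γ.Homotopic (circleLoop n) := by
  obtain ⟨H⟩ := SimplyConnectedSpace.paths_homotopic Γ (circleLoopLift n)
  exact ⟨(H.compContinuousMap Circle.exp).cast (ContinuousMap.ext h) rfl⟩

/-- The lift of `circleLoop n` through `Circle.exp` starting at `0` is linear. -/
theorem circleLoopLift_eq_liftPath (n : ℤ) :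
    (circleLoopLift n).toContinuousMap =
      Circle.isCoveringMap_exp.liftPath (circleLoop n).toContinuousMap 0 (by simp) :=
  (Circle.isCoveringMap_exp.eq_liftPath_iff' (by simp)).mpr ⟨rfl, by simp⟩

/-- Standard loops are homotopic exactly when their indices agree. -/
theorem circleLoop_homotopic_iff {m n : ℤ} :
    (circleLoop m).Homotopic (circleLoop n) ↔ m = n := by
  refine ⟨fun h ↦ ?_, fun h ↦ h ▸ .refl _⟩
  have key := Circle.isCoveringMap_exp.liftPath_apply_one_eq_of_homotopicRel h 0
    (by simp) (by simp)
  rw [← circleLoopLift_eq_liftPath, ← circleLoopLift_eq_liftPath] at key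
  simpa [pi_ne_zero] using key

/-- Every loop in the circle based at `1` is path-homotopic (rel endpoints) to the
standard loop `eₙ` for exactly one integer `n`. -/
theorem exists_unique_homotopic_circleLoop (γ : Path (1 : Circle) 1) :
    ∃! n : ℤ, γ.Homotopic (circleLoop n) := by
  obtain ⟨Γ, hΓ, hΓ₀⟩ := Circle.isCoveringMap_exp.exists_path_lifts γ 0 (by simp)
  have hΓ₁ : Circle.exp (Γ 1) = 1 := by simpa using congrFun hΓ 1
  obtain ⟨n, hn⟩ := Circle.exp_eq_one.mp hΓ₁
  have h : γ.Homotopic (circleLoop n) :=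
    homotopic_circleLoop_of_lift ⟨Γ, hΓ₀, by simpa [mul_comm] using hn⟩ (congrFun hΓ)
  exact ⟨n, h, fun m hm ↦ circleLoop_homotopic_iff.mp (hm.symm.trans h)⟩
end

section
/- For every n ≥ 2, the n-th homotopy group of the circle is trivial: πₙ(S¹, 1) has exactly one element. -/
open scoped Topology

open scoped unitInterval Topology.Homotopy in
/-- A lift, along a covering map, of a generalized loop of dimension at least two takes
a single value on the boundary of the cube. -/
theorem IsCoveringMap.lift_genLoop_eq_of_mem_boundary {E X N : Type*} [TopologicalSpace E]
    [TopologicalSpace X] [Nontrivial N] {p : E → X} (hp : IsCoveringMap p) {x : X}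
    (f : Ω^ N X x) (F : C(I^N, E)) (hF : ∀ y, p (F y) = f y) :
    ∀ y ∈ Cube.boundary N, F y = F 0 := by
  classical
  have face (i : N) (c : I) (hc : c = 0 ∨ c = 1) (y z : I^N) (hy : y i = c) (hz : z i = c) :
      F y = F z := by
    have hG : Continuous fun w : I^N ↦ F (Function.update w i c) := by fun_prop
    have key := hp.const_of_comp hG (fun a b ↦ by
      simp only [hF]
      rw [GenLoop.boundary f _ ⟨i, by simpa using hc⟩, GenLoop.boundary f _ ⟨i, by simpa using hc⟩]) y z
    have hy' : Function.update y i c = y := by rw [← hy, Function.update_eq_self]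
    have hz' : Function.update z i c = z := by rw [← hz, Function.update_eq_self]
    simpa only [hy', hz'] using key
  rintro y ⟨i, hi⟩
  obtain ⟨j, hj⟩ := exists_ne i
  calc F y = F (Function.update y j 0) :=
        face i (y i) hi _ _ rfl (Function.update_of_ne hj.symm _ _)
    _ = F 0 := face j 0 (Or.inl rfl) _ _ (Function.update_self ..) rfl

open scoped unitInterval Topology.Homotopy in
/-- Every generalized loop of dimension at least two in the circle is null-homotopic. -/
theorem GenLoop.homotopic_const_circle {N : Type*} [Nontrivial N] (f : Ω^ N Circle 1) :
    GenLoop.Homotopic f GenLoop.const := by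
  have hf0 : f 0 = 1 := GenLoop.boundary f _ ⟨Classical.arbitrary N, Or.inl rfl⟩
  let H : C(I × (I^N), Circle) :=
    f.1.comp ⟨fun q i ↦ q.1 * q.2 i, by fun_prop⟩
  have H_0 (a : I^N) : H (0, a) = Circle.exp ((ContinuousMap.const (I^N) (0 : ℝ)) a) := by
    have h0 : (fun i ↦ (0 : I) * a i) = 0 := by ext; simp
    change f (fun i ↦ (0 : I) * a i) = _
    rw [h0, hf0, ContinuousMap.const_apply, Circle.exp_zero]
  let L := Circle.isCoveringMap_exp.liftHomotopy H (.const _ 0) H_0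
  have hL (q : I × (I^N)) : Circle.exp (L q) = H q :=
    congrFun (Circle.isCoveringMap_exp.liftHomotopy_lifts H (.const _ 0) H_0) q
  let F : C(I^N, ℝ) := L.comp ⟨fun y ↦ (1, y), by fun_prop⟩
  have hF (y : I^N) : Circle.exp (F y) = f y := by
    change Circle.exp (L (1, y)) = _
    rw [hL]
    change f (fun i ↦ (1 : I) * y i) = f y
    simp
  have hconst := Circle.isCoveringMap_exp.lift_genLoop_eq_of_mem_boundary f F hF
  refine ⟨⟨⟨⟨fun q ↦ Circle.exp (F q.2 - q.1 * (F q.2 - F 0)), by fun_prop⟩, fun y ↦ ?_,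
    fun y ↦ ?_⟩, fun t y hy ↦ ?_⟩⟩
  · simp [hF]
  · simp [hF, hf0]
  · simp [hconst y hy, ← hF]

/-- For every `n ≥ 2`, the `n`-th homotopy group of the circle is trivial:
`πₙ(S¹, 1)` has exactly one element. -/
theorem homotopyGroup_circle_trivial (n : ℕ) (hn : 2 ≤ n) :
    Nonempty (Unique (π_ n Circle (1 : Circle))) := by
  have : Nontrivial (Fin n) := Fin.nontrivial_iff_two_le.mpr hn
  refine ⟨⟨⟨Quotient.mk _ GenLoop.const⟩, fun a ↦ ?_⟩⟩
  induction a using Quotient.inductionOn with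
  | h f => exact Quotient.sound (GenLoop.homotopic_const_circle f)
end
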